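/- arXiv:2312.09889 — 2 statements merged into one kernel-verified Lean document; each statement's English description precedes it below -/
import Mathlib

section
/- For every natural number n, the following square is a pushout in the category Cat of small categories: top map [0] → [n] picking the object 0, left map [0] → [1] picking the object 1, right map d₀ : [n] → [n+1] given by i ↦ i+1, bottom map e₁ : [1] → [n+1] given by 0 ↦ 0 and 1 ↦ 1 (all posets regarded as categories, all maps as the corresponding order-preserving functors). -/
open CategoryTheory

/-- The poset `[m] = {0 < 1 < ⋯ < m}` regarded as an object of `Cat`. -/
def ordCat (m : ℕ) : Cat := Cat.of (Fin (m + 1))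

/-- The functor between poset categories induced by a monotone map. -/
def ordFunctor {m m' : ℕ} (f : Fin (m + 1) → Fin (m' + 1)) (hf : Monotone f) :
    ordCat m ⟶ ordCat m' :=
  (hf.functor : Fin (m + 1) ⥤ Fin (m' + 1)).toCatHom

/-- The restriction of a chain of `n + 1` composable arrows along `Fin.castLE : [1] → [n + 1]`:
its first arrow. -/
def CategoryTheory.ComposableArrows.firstArrow {C : Type*} [Category C] {n : ℕ}
    (H : ComposableArrows C (n + 1)) : ComposableArrows C 1 :=
  H.whiskerLeft (Monotone.functor (f := fun i : Fin 2 => Fin.castLE (by omega) i)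
    (fun _ _ h => by simpa using h))

theorem CategoryTheory.ComposableArrows.eq_of_δ₀_eq_of_firstArrow_eq
    {C : Type*} [Category C] {n : ℕ}
    {H K : ComposableArrows C (n + 1)} (hδ : H.δ₀ = K.δ₀) (h : firstArrow H = firstArrow K) :
    H = K := by
  refine ComposableArrows.ext_succ (Functor.congr_obj h 0) hδ ?_
  exact Functor.congr_hom h (homOfLE (Fin.zero_le 1))

theorem CategoryTheory.ComposableArrows.firstArrow_precomp {C : Type*} [Category C] {n : ℕ}
    (F : ComposableArrows C n) (G : ComposableArrows C 1) (h : F.left = G.right) :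
    firstArrow (F.precomp (G.hom ≫ eqToHom h.symm)) = G := by
  refine ComposableArrows.ext₁ rfl h ?_
  exact (Category.id_comp _).symm

/-- for every `n`, the square in `Cat` with top map `[0] → [n]` picking `0`,
left map `[0] → [1]` picking `1`, right map `d₀ : [n] → [n+1]`, `i ↦ i + 1`, and bottom map
`e₁ : [1] → [n+1]`, `0 ↦ 0, 1 ↦ 1`, is a pushout. -/
theorem ordCat_isPushout (n : ℕ) :
    IsPushout
      (ordFunctor (m := 0) (m' := n) (fun _ => 0) monotone_const)
      (ordFunctor (m := 0) (m' := 1) (fun _ => 1) monotone_const)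
      (ordFunctor (m := n) (m' := n + 1) (fun i => i.succ)
        (fun _ _ h => Fin.succ_le_succ_iff.mpr h))
      (ordFunctor (m := 1) (m' := n + 1) (fun i => Fin.castLE (by omega) i)
        (fun _ _ h => by simpa using h)) := by
  have w (s : Limits.PushoutCocone
      (ordFunctor (m := 0) (m' := n) (fun _ => 0) monotone_const)
      (ordFunctor (m := 0) (m' := 1) (fun _ => 1) monotone_const)) :
      s.inl.toFunctor.obj (0 : Fin (n + 1)) = s.inr.toFunctor.obj (1 : Fin 2) :=
    Functor.congr_obj (congrArg Cat.Hom.toFunctor s.condition) (0 : Fin 1)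
  refine ⟨⟨rfl⟩, ⟨Limits.PushoutCocone.IsColimit.mk _
    (fun s => Functor.toCatHom (ComposableArrows.precomp (n := n) s.inl.toFunctor
      (ComposableArrows.hom (C := s.pt) s.inr.toFunctor ≫ eqToHom (w s).symm)))
    (fun s => ?_) (fun s => ?_) (fun s m hl hr => ?_)⟩⟩
  · rfl
  · exact Cat.Hom.ext (ComposableArrows.firstArrow_precomp (C := s.pt) _ _ (w s))
  · exact Cat.Hom.ext (ComposableArrows.eq_of_δ₀_eq_of_firstArrow_eq (C := s.pt)
      (congrArg Cat.Hom.toFunctor hl) ((congrArg Cat.Hom.toFunctor hr).trans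
        (ComposableArrows.firstArrow_precomp (C := s.pt) _ _ (w s)).symm))
end

section
/- Let X and Y be simplicial sets that are strict Segal and complete, and let φ : X → Y be a map of simplicial sets such that (i) φ₀ : X₀ → Y₀ is surjective, and (ii) for all x, x' ∈ X₀ the induced map {f ∈ X₁ : d₁(f) = x, d₀(f) = x'} → {g ∈ Y₁ : d₁(g) = φ(x), d₀(g) = φ(x')} is a bijection. Then φ is an isomorphism of simplicial sets. -/
open CategoryTheory Simplicial

/-- An edge `f` of a simplicial set `X` is an equivalence if there are `2`-simplices
`σ`, `τ` with `d₀(σ) = f`, `d₂(τ) = f` and both `d₁(σ)`, `d₁(τ)` degenerate. -/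
def SSet.IsEquivalenceEdge (X : SSet) (f : X _⦋1⦌) : Prop :=
  ∃ (σ τ : X _⦋2⦌),
    X.δ 0 σ = f ∧ X.δ 2 τ = f ∧
    (∃ a : X _⦋0⦌, X.σ 0 a = X.δ 1 σ) ∧
    (∃ b : X _⦋0⦌, X.σ 0 b = X.δ 1 τ)

/-- A simplicial set is complete if the degeneracy `s₀ : X₀ → X₁` is a bijection onto the
set of equivalences: it is injective, and every equivalence edge is degenerate. -/
def SSet.IsComplete (X : SSet) : Prop :=
  Function.Injective (X.σ (0 : Fin 1)) ∧
    ∀ f : X _⦋1⦌, X.IsEquivalenceEdge f → ∃ x : X _⦋0⦌, X.σ 0 x = f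

namespace SSet

universe u

variable {X Y : SSet.{u}}

/-- Taking spines is natural. -/
lemma spine_app (φ : X ⟶ Y) (n : ℕ) (s : X _⦋n⦌) :
    Y.spine n (φ.app _ s) = (X.spine n s).map φ := by
  apply Path.ext
  · funext i
    exact (NatTrans.naturality_apply φ (SimplexCategory.const ⦋0⦌ ⦋n⦌ i).op s).symm
  · funext i
    exact (NatTrans.naturality_apply φ (SimplexCategory.mkOfSucc i).op s).symm

lemma spine_two_arrow_zero (s : X _⦋2⦌) : (X.spine 2 s).arrow 0 = X.δ 2 s := by
  have h : SimplexCategory.mkOfSucc (0 : Fin 2) = SimplexCategory.δ 2 := by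
    ext i
    fin_cases i <;> rfl
  rw [spine_arrow, h]
  rfl

lemma spine_two_arrow_one (s : X _⦋2⦌) : (X.spine 2 s).arrow 1 = X.δ 0 s := by
  have h : SimplexCategory.mkOfSucc (1 : Fin 2) = SimplexCategory.δ 0 := by
    ext i
    fin_cases i <;> rfl
  rw [spine_arrow, h]
  rfl

/-- The path of length `2` formed by two composable edges. -/
def Path.ofEdges (f g : X _⦋1⦌) (h : X.δ 0 f = X.δ 1 g) : Path X 2 where
  vertex := ![X.δ 1 f, X.δ 0 f, X.δ 0 g]
  arrow := ![f, g]
  arrow_src i := by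
    fin_cases i
    · rfl
    · exact h.symm
  arrow_tgt i := by
    fin_cases i <;> rfl

lemma exists_two_simplex_of_spine_surjective (hX : Function.Surjective (X.spine 2))
    (f g : X _⦋1⦌) (h : X.δ 0 f = X.δ 1 g) :
    ∃ s : X _⦋2⦌, X.δ 2 s = f ∧ X.δ 0 s = g := by
  obtain ⟨s, hs⟩ := hX (Path.ofEdges f g h)
  refine ⟨s, ?_, ?_⟩
  · rw [← spine_two_arrow_zero, hs]
    rfl
  · rw [← spine_two_arrow_one, hs]
    rfl

lemma two_simplex_ext_of_spine_injective (hX : Function.Injective (X.spine 2))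
    {s t : X _⦋2⦌} (h₂ : X.δ 2 s = X.δ 2 t) (h₀ : X.δ 0 s = X.δ 0 t) : s = t := by
  apply hX
  apply Path.ext'
  intro i
  fin_cases i
  · exact (spine_two_arrow_zero s).trans (h₂.trans (spine_two_arrow_zero t).symm)
  · exact (spine_two_arrow_one s).trans (h₀.trans (spine_two_arrow_one t).symm)

/-- If `2`-simplices are determined by their spines, a `2`-simplex whose outer faces are both the
degenerate edge at `y` also has that edge as its inner face. -/
lemma δ_one_eq_σ_zero_of_outer_faces (hY : Function.Injective (Y.spine 2)) (y : Y _⦋0⦌)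
    {s : Y _⦋2⦌} (h₂ : Y.δ 2 s = Y.σ 0 y) (h₀ : Y.δ 0 s = Y.σ 0 y) :
    Y.δ 1 s = Y.σ 0 y := by
  have hs : s = Y.σ 0 (Y.σ 0 y) := by
    refine two_simplex_ext_of_spine_injective hY ?_ ?_
    · rw [h₂]
      have h := δ_comp_σ_of_gt_apply (S := Y) (i := (1 : Fin 2)) (j := (0 : Fin 1))
        (by decide) (Y.σ 0 y)
      refine Eq.trans ?_ h.symm
      exact congrArg _ (δ_comp_σ_succ_apply (S := Y) (0 : Fin 1) y).symm
    · rw [h₀]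
      exact (δ_comp_σ_self_apply (S := Y) (0 : Fin 2) (Y.σ 0 y)).symm
  rw [hs]
  exact δ_comp_σ_succ_apply (S := Y) (0 : Fin 2) (Y.σ 0 y)

/-- A map that is bijective on vertices and edges is bijective on paths. -/
lemma Path.map_bijective (φ : X ⟶ Y)
    (h0 : Function.Bijective (φ.app (Opposite.op ⦋0⦌)))
    (h1 : Function.Bijective (φ.app (Opposite.op ⦋1⦌))) (n : ℕ) :
    Function.Bijective (fun p : Path X n ↦ p.map φ) := by
  constructor
  · intro p q h
    apply Path.ext
    · funext i
      exact h0.1 (Path.congr_vertex h i)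
    · funext i
      exact h1.1 (Path.congr_arrow h i)
  · intro q
    choose v hv using fun i ↦ h0.2 (q.vertex i)
    choose a ha using fun i ↦ h1.2 (q.arrow i)
    refine ⟨⟨v, a, fun i ↦ h0.1 ?_, fun i ↦ h0.1 ?_⟩, ?_⟩
    · refine (δ_naturality_apply φ 1 (a i)).trans ?_
      rw [ha, q.arrow_src, hv]
    · refine (δ_naturality_apply φ 0 (a i)).trans ?_
      rw [ha, q.arrow_tgt, hv]
    · apply Path.ext
      · funext i
        exact hv i
      · funext i
        exact ha i

/-- A map of strict Segal simplicial sets that is bijective on vertices and edges is an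
isomorphism. -/
lemma isIso_of_bijective_on_vertices_and_edges (φ : X ⟶ Y)
    (hX : ∀ n : ℕ, Function.Bijective (X.spine n))
    (hY : ∀ n : ℕ, Function.Bijective (Y.spine n))
    (h0 : Function.Bijective (φ.app (Opposite.op ⦋0⦌)))
    (h1 : Function.Bijective (φ.app (Opposite.op ⦋1⦌))) : IsIso φ := by
  have h (n : ℕ) : Function.Bijective (φ.app (Opposite.op ⦋n⦌)) := by
    rw [← Function.Bijective.of_comp_iff' (hY n)]
    convert (Path.map_bijective φ h0 h1 n).comp (hX n) using 1
    funext s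
    exact spine_app φ n s
  have (n : SimplexCategoryᵒᵖ) : IsIso (φ.app n) := by
    rw [isIso_iff_bijective]
    exact h n.unop.len
  exact NatIso.isIso_of_isIso_app φ

/-- A map that is bijective on morphism sets and whose source is complete is injective on
vertices. -/
lemma injective_on_vertices (φ : X ⟶ Y)
    (hX : Function.Surjective (X.spine 2)) (hY : Function.Injective (Y.spine 2))
    (hXc : X.IsComplete)
    (h1 : ∀ (x x' : X _⦋0⦌) (g : Y _⦋1⦌),
      Y.δ 1 g = φ.app _ x → Y.δ 0 g = φ.app _ x' →
      ∃! f : X _⦋1⦌, X.δ 1 f = x ∧ X.δ 0 f = x' ∧ φ.app _ f = g) :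
    Function.Injective (φ.app (Opposite.op ⦋0⦌)) := by
  intro x x' hxx'
  have src {Z : SSet.{u}} (z : Z _⦋0⦌) : Z.δ 1 (Z.σ 0 z) = z :=
    δ_comp_σ_succ_apply (S := Z) (0 : Fin 1) z
  have tgt {Z : SSet.{u}} (z : Z _⦋0⦌) : Z.δ 0 (Z.σ 0 z) = z :=
    δ_comp_σ_self_apply (S := Z) (0 : Fin 1) z
  have comp_degenerate {a b : X _⦋0⦌} (hab : φ.app _ a = φ.app _ b) {p q : X _⦋1⦌}
      (pa : X.δ 1 p = a) (pb : X.δ 0 p = b) (qb : X.δ 1 q = b) (qa : X.δ 0 q = a)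
      (hp : φ.app _ p = Y.σ 0 (φ.app _ a)) (hq : φ.app _ q = Y.σ 0 (φ.app _ a)) :
      ∃ s : X _⦋2⦌, X.δ 2 s = p ∧ X.δ 0 s = q ∧ X.σ 0 a = X.δ 1 s := by
    obtain ⟨s, hs₂, hs₀⟩ := exists_two_simplex_of_spine_surjective hX p q (pb.trans qb.symm)
    refine ⟨s, hs₂, hs₀, ?_⟩
    refine (h1 a a (Y.σ 0 (φ.app _ a)) (src _) (tgt _)).unique
      ⟨src _, tgt _, σ_naturality_apply φ 0 a⟩ ⟨?_, ?_, ?_⟩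
    · rw [← pa, ← hs₂]
      exact (δ_comp_δ_self_apply (S := X) (i := (1 : Fin 2)) s)
    · rw [← qa, ← hs₀]
      exact (δ_comp_δ_self_apply (S := X) (i := (0 : Fin 2)) s).symm
    · rw [δ_naturality_apply]
      apply δ_one_eq_σ_zero_of_outer_faces hY
      · rw [← δ_naturality_apply, hs₂, hp]
      · rw [← δ_naturality_apply, hs₀, hq]
  obtain ⟨f, ⟨fx, fx', hf⟩, -⟩ := h1 x x' (Y.σ 0 (φ.app _ x)) (src _) ((tgt _).trans hxx')
  obtain ⟨g, ⟨gx', gx, hg⟩, -⟩ := h1 x' x (Y.σ 0 (φ.app _ x)) ((src _).trans hxx') (tgt _)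
  obtain ⟨s, -, hs₀, hs⟩ := comp_degenerate hxx'.symm gx' gx fx fx' (by rw [hg, hxx'])
    (by rw [hf, hxx'])
  obtain ⟨t, ht₂, -, ht⟩ := comp_degenerate hxx' fx fx' gx' gx hf hg
  obtain ⟨z, rfl⟩ := hXc.2 f ⟨s, t, hs₀, ht₂, ⟨_, hs⟩, ⟨_, ht⟩⟩
  rw [← fx, ← fx', src, tgt]

end SSet

/-- a map of complete strict Segal simplicial sets which is surjective on
`0`-simplices and bijective on all morphism sets is an isomorphism of simplicial sets. -/
theorem isIso_of_surjective_on_objects_and_bijective_on_homs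
    (X Y : SSet) (φ : X ⟶ Y)
    (hX : ∀ n : ℕ, Function.Bijective (X.spine n))
    (hY : ∀ n : ℕ, Function.Bijective (Y.spine n))
    (hXc : X.IsComplete) (hYc : Y.IsComplete)
    (h0 : Function.Surjective (φ.app (Opposite.op ⦋0⦌)))
    (h1 : ∀ (x x' : X _⦋0⦌) (g : Y _⦋1⦌),
      Y.δ 1 g = φ.app _ x → Y.δ 0 g = φ.app _ x' →
      ∃! f : X _⦋1⦌, X.δ 1 f = x ∧ X.δ 0 f = x' ∧ φ.app _ f = g) :
    IsIso φ := by
  have hinj := SSet.injective_on_vertices φ (hX 2).2 (hY 2).1 hXc h1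
  refine SSet.isIso_of_bijective_on_vertices_and_edges φ hX hY ⟨hinj, h0⟩ ⟨?_, ?_⟩
  · intro f f' h
    refine (h1 (X.δ 1 f) (X.δ 0 f) (φ.app _ f) ?_ ?_).unique ⟨rfl, rfl, rfl⟩
      ⟨hinj ?_, hinj ?_, h.symm⟩
    all_goals simp only [SSet.δ_naturality_apply, h]
  · intro g
    obtain ⟨x, hx⟩ := h0 (Y.δ 1 g)
    obtain ⟨x', hx'⟩ := h0 (Y.δ 0 g)
    obtain ⟨f, ⟨-, -, hf⟩, -⟩ := h1 x x' g hx.symm hx'.symm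
    exact ⟨f, hf⟩
end
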